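/- Let U₁,…,U_p be real polynomials in d variables and set U = Σ_{j=1}^p U_j². Then there exists C > 0 such that for all complex-valued u ∈ C_0^∞(ℝ^d), Σ_{j,ℓ=1}^d ‖ ∂²u/∂x_j∂x_ℓ ‖ + ‖ U u ‖ ≤ C ‖ (−Δ + U) u ‖, where all norms are L²(ℝ^d) norms. -/

import Mathlib

open MeasureTheory Real Filter

noncomputable section

/-- `ℝ^d` with the Euclidean structure. -/
abbrev Rd (d : ℕ) := EuclideanSpace ℝ (Fin d)

/-- Partial derivative `∂_{x_j}` of a complex-valued function. -/
def pdC {d : ℕ} (j : Fin d) (f : Rd d → ℂ) : Rd d → ℂ :=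
  fun x => fderiv ℝ f x (EuclideanSpace.single j (1:ℝ))

/-- Partial derivative `∂_{x_j}` of a real-valued function. -/
def pdR {d : ℕ} (j : Fin d) (f : Rd d → ℝ) : Rd d → ℝ :=
  fun x => fderiv ℝ f x (EuclideanSpace.single j (1:ℝ))

/-- Iterated partial derivative in the `j`-th direction. -/
def pdIter {d : ℕ} (j : Fin d) : ℕ → (Rd d → ℝ) → (Rd d → ℝ)
  | 0, f => f
  | n+1, f => pdR j (pdIter j n f)

/-- Multi-index partial derivative `∂^α`. -/
def pdMulti {d : ℕ} (α : Fin d → ℕ) (f : Rd d → ℝ) : Rd d → ℝ :=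
  (List.finRange d).foldr (fun j g => pdIter j (α j) g) f

/-- The finite set of multi-indices `α` with `|α| = q`. -/
def mIdx (d q : ℕ) : Finset (Fin d → ℕ) := Finset.Nat.antidiagonalTuple d q

/-- The magnetic field `B_{jk} = ∂_j A_k - ∂_k A_j`. -/
def magB {d : ℕ} (A : Fin d → Rd d → ℝ) (j k : Fin d) : Rd d → ℝ :=
  fun x => pdR j (A k) x - pdR k (A j) x

/-- The quantity `m̌_q(x)`. -/
def mq {d p : ℕ} (A : Fin d → Rd d → ℝ) (U : Fin p → Rd d → ℝ) (V : Rd d → ℝ) :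
    ℕ → Rd d → ℝ
  | 0, x => ∑ ℓ, |U ℓ x|
  | q+1, x =>
      (∑ ℓ, ∑ α ∈ mIdx d (q+1), |pdMulti α (U ℓ) x|)
      + (∑ jk ∈ Finset.univ.filter (fun jk : Fin d × Fin d => jk.1 < jk.2),
          ∑ α ∈ mIdx d q, |pdMulti α (magB A jk.1 jk.2) x|)
      + ∑ α ∈ mIdx d q, |pdMulti α V x|

/-- The quantity `m̌ʳ(x) = 1 + ∑_{q=0}^r m̌_q(x)`. -/
def mr {d p : ℕ} (A : Fin d → Rd d → ℝ) (U : Fin p → Rd d → ℝ) (V : Rd d → ℝ)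
    (r : ℕ) (x : Rd d) : ℝ :=
  1 + ∑ q ∈ Finset.range (r+1), mq A U V q x

/-- The magnetic derivative `X_j u = (D_{x_j} - A_j) u`, `D_{x_j} = -i ∂_{x_j}`. -/
def Xop {d : ℕ} (A : Fin d → Rd d → ℝ) (j : Fin d) (u : Rd d → ℂ) : Rd d → ℂ :=
  fun x => -Complex.I * pdC j u x - (A j x : ℂ) * u x

/-- The potential `W = ∑_ℓ U_ℓ² + iV`. -/
def Wfun {d p : ℕ} (U : Fin p → Rd d → ℝ) (V : Rd d → ℝ) (x : Rd d) : ℂ :=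
  ((∑ ℓ, (U ℓ x)^2 : ℝ) : ℂ) + (V x : ℝ) * Complex.I

/-- The operator `P_{A,W} u = ∑_j X_j² u + W u` with `W = ∑_ℓ U_ℓ² + iV`. -/
def Pop {d p : ℕ} (A : Fin d → Rd d → ℝ) (U : Fin p → Rd d → ℝ) (V : Rd d → ℝ)
    (u : Rd d → ℂ) : Rd d → ℂ :=
  fun x => (∑ j, Xop A j (Xop A j u) x) + Wfun U V x * u x

/-- The function `Φ(x,t)`. -/
def Phi {d p : ℕ} (A : Fin d → Rd d → ℝ) (U : Fin p → Rd d → ℝ) (V : Rd d → ℝ)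
    (r : ℕ) (x : Rd d) (t : ℝ) : ℝ :=
  (∑ ℓ, ∑ q ∈ Finset.range (r+1), t^(q+1) * ∑ α ∈ mIdx d q, |pdMulti α (U ℓ) x|)
  + (∑ jk ∈ Finset.univ.filter (fun jk : Fin d × Fin d => jk.1 < jk.2),
      ∑ q ∈ Finset.range r, t^(q+2) * ∑ α ∈ mIdx d q, |pdMulti α (magB A jk.1 jk.2) x|)
  + ∑ q ∈ Finset.range r, t^(q+2) * ∑ α ∈ mIdx d q, |pdMulti α V x|

/-- `R(x,μ) = sup { t ∈ [0,1] : Φ(x,t) ≤ μ }`. -/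
def Rfun {d p : ℕ} (A : Fin d → Rd d → ℝ) (U : Fin p → Rd d → ℝ) (V : Rd d → ℝ)
    (r : ℕ) (x : Rd d) (μ : ℝ) : ℝ :=
  sSup {t : ℝ | t ∈ Set.Icc (0:ℝ) 1 ∧ Phi A U V r x t ≤ μ}



open scoped ContDiff

lemma pdR_smooth {d : ℕ} {f : Rd d → ℝ} (hf : ContDiff ℝ ∞ f) (j : Fin d) :
    ContDiff ℝ ∞ (pdR j f) := by
  unfold pdR
  exact (hf.fderiv_right (m := ∞) (by simp)).clm_apply contDiff_const

lemma smooth_diff {d : ℕ} {f : Rd d → ℝ} (hf : ContDiff ℝ ∞ f) : Differentiable ℝ f :=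
  hf.differentiable (by simp)

lemma pdR_mul {d : ℕ} {f g : Rd d → ℝ} (hf : ContDiff ℝ ∞ f) (hg : ContDiff ℝ ∞ g) (j : Fin d)
    (x : Rd d) : pdR j (fun y => f y * g y) x = pdR j f x * g x + f x * pdR j g x := by
  unfold pdR
  rw [fderiv_fun_mul (smooth_diff hf x) (smooth_diff hg x)]
  simp
  ring

lemma pdR_add {d : ℕ} {f g : Rd d → ℝ} (hf : ContDiff ℝ ∞ f) (hg : ContDiff ℝ ∞ g) (j : Fin d)
    (x : Rd d) : pdR j (fun y => f y + g y) x = pdR j f x + pdR j g x := by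
  unfold pdR
  rw [fderiv_fun_add (smooth_diff hf x) (smooth_diff hg x)]
  simp

lemma pdR_sum {d : ℕ} {ι : Type*} (s : Finset ι) {f : ι → Rd d → ℝ}
    (hf : ∀ i ∈ s, ContDiff ℝ ∞ (f i)) (j : Fin d)
    (x : Rd d) : pdR j (fun y => ∑ i ∈ s, f i y) x = ∑ i ∈ s, pdR j (f i) x := by
  unfold pdR
  rw [fderiv_fun_sum (fun i hi => smooth_diff (hf i hi) x)]
  simp

lemma pdR_pow {d : ℕ} {f : Rd d → ℝ} (hf : ContDiff ℝ ∞ f) (n : ℕ) (j : Fin d)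
    (x : Rd d) : pdR j (fun y => f y ^ n) x = n * f x ^ (n - 1) * pdR j f x := by
  unfold pdR
  rw [fderiv_fun_pow n (smooth_diff hf x)]
  simp

lemma pdR_div_const {d : ℕ} {f : Rd d → ℝ} (hf : ContDiff ℝ ∞ f) (c : ℝ) (j : Fin d)
    (x : Rd d) : pdR j (fun y => f y / c) x = pdR j f x / c := by
  have : (fun y => f y / c) = fun y => f y * (fun _ => c⁻¹) y := by
    funext y; simp [div_eq_mul_inv]
  rw [this, pdR_mul hf contDiff_const]
  simp [pdR, div_eq_mul_inv]

lemma pdR_inv {d : ℕ} {f : Rd d → ℝ} (hf : ContDiff ℝ ∞ f) (h0 : ∀ x, 0 < f x) (j : Fin d)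
    (x : Rd d) : pdR j (fun y => (f y)⁻¹) x = - pdR j f x / f x ^ 2 := by
  have hs : ContDiff ℝ ∞ (fun y => (f y)⁻¹) := hf.inv (fun y => (h0 y).ne')
  have h1 : (fun y => f y * (f y)⁻¹) = fun _ => (1:ℝ) := by
    funext y; exact mul_inv_cancel₀ (h0 y).ne'
  have h2 := pdR_mul hf hs j x
  rw [h1] at h2
  have h3 : pdR j (fun _ : Rd d => (1:ℝ)) x = 0 := by simp [pdR]
  rw [h3] at h2
  have := (h0 x).ne'
  field_simp
  field_simp at h2
  linarith

lemma pdR_comm {d : ℕ} {f : Rd d → ℝ} (hf : ContDiff ℝ ∞ f) (i j : Fin d) (x : Rd d) :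
    pdR i (pdR j f) x = pdR j (pdR i f) x := by
  have hsym : IsSymmSndFDerivAt ℝ f x := by
    apply hf.contDiffAt.isSymmSndFDerivAt
    simp only [minSmoothness_of_isRCLikeNormedField]
    exact ENat.LEInfty.out
  have hd : DifferentiableAt ℝ (fderiv ℝ f) x :=
    ((hf.fderiv_right (m := ∞) (by simp)).differentiable (by simp)) x
  have key : ∀ i j : Fin d, pdR i (pdR j f) x =
      fderiv ℝ (fderiv ℝ f) x (EuclideanSpace.single i (1:ℝ)) (EuclideanSpace.single j (1:ℝ)) := by
    intro i j
    unfold pdR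
    rw [fderiv_clm_apply hd (differentiableAt_const _)]
    simp
  rw [key, key, hsym.eq]

lemma pdR_supp {d : ℕ} {f : Rd d → ℝ} (hf : HasCompactSupport f) (j : Fin d) :
    HasCompactSupport (pdR j f) := by
  exact (hf.fderiv ℝ).comp_left (g := fun (A : Rd d →L[ℝ] ℝ) => A (EuclideanSpace.single j (1:ℝ))) (by simp)

lemma smooth_integrable {d : ℕ} {f : Rd d → ℝ} (hf : ContDiff ℝ ∞ f) (h : HasCompactSupport f) :
    Integrable f := hf.continuous.integrable_of_hasCompactSupport h

lemma integral_pdR {d : ℕ} {f : Rd d → ℝ} (hf : ContDiff ℝ ∞ f) (h : HasCompactSupport f)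
    (j : Fin d) : ∫ x, pdR j f x = 0 := by
  have := integral_mul_fderiv_eq_neg_fderiv_mul_of_integrable (𝕜 := ℝ) (μ := (volume : Measure (Rd d)))
    (f := fun _ => (1:ℝ)) (g := f) (v := EuclideanSpace.single j (1:ℝ)) (by simp) 
    (by simp only [one_mul]; exact smooth_integrable (pdR_smooth hf j) (pdR_supp h j))
    (by simpa using smooth_integrable hf h) (by fun_prop) (fun x _ => smooth_diff hf x)
  simpa [pdR] using this

/-- evaluation of a polynomial on `ℝ^d` -/
def ev {d : ℕ} (q : MvPolynomial (Fin d) ℝ) (x : Rd d) : ℝ := MvPolynomial.eval (fun i => x i) q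

lemma ev_smooth {d : ℕ} (q : MvPolynomial (Fin d) ℝ) : ContDiff ℝ ∞ (ev q) := by
  induction q using MvPolynomial.induction_on with
  | C a => unfold ev; simp; exact contDiff_const
  | add p q hp hq =>
    have : ev (p + q) = fun x => ev p x + ev q x := by funext x; simp [ev]
    rw [this]; exact hp.add hq
  | mul_X p i hp =>
    have : ev (p * MvPolynomial.X i) = fun x => ev p x * x i := by funext x; simp [ev]
    rw [this]
    exact hp.mul (by fun_prop)

lemma pdR_ev {d : ℕ} (q : MvPolynomial (Fin d) ℝ) (j : Fin d) :
    pdR j (ev q) = ev (MvPolynomial.pderiv j q) := by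
  induction q using MvPolynomial.induction_on with
  | C a => 
    have : ev (MvPolynomial.C a : MvPolynomial (Fin d) ℝ) = fun x => a := by funext x; simp [ev]
    rw [this]; funext x; simp [ev, pdR]
  | add p q hp hq =>
    have : ev (p + q) = fun x => ev p x + ev q x := by funext x; simp [ev]
    rw [this]; funext x; rw [pdR_add (ev_smooth p) (ev_smooth q), hp, hq]; simp [ev]
  | mul_X p i hp =>
    have : ev (p * MvPolynomial.X i) = fun x => ev p x * (fun y : Rd d => y i) x := by funext x; simp [ev]
    rw [this]
    funext x
    rw [pdR_mul (ev_smooth p) (by fun_prop), hp]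
    have h2 : pdR j (fun y : Rd d => y i) x = if j = i then 1 else 0 := by
      have : (fun y : Rd d => y i) = EuclideanSpace.proj (𝕜 := ℝ) i := by funext y; simp
      unfold pdR
      rw [this, ContinuousLinearMap.fderiv]
      show (EuclideanSpace.single j (1:ℝ) : Rd d) i = _
      simp only [PiLp.single_apply, @eq_comm _ i j]
    rw [h2]
    simp only [ev, MvPolynomial.pderiv_mul, map_add, map_mul, MvPolynomial.eval_X, MvPolynomial.pderiv_X, Pi.single_apply]
    by_cases hij : j = i
    · subst hij; simp
    · simp [hij, Ne.symm hij]

open Classical in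
/-- All iterated partial derivatives of order `a` of the polynomials `U k`. -/
def Fam {d p : ℕ} (U : Fin p → MvPolynomial (Fin d) ℝ) : ℕ → Finset (MvPolynomial (Fin d) ℝ)
  | 0 => Finset.univ.image U
  | a + 1 => (Fam U a ×ˢ Finset.univ).image (fun s => MvPolynomial.pderiv s.2 s.1)

lemma mem_Fam_zero {d p : ℕ} (U : Fin p → MvPolynomial (Fin d) ℝ) (q) :
    q ∈ Fam U 0 ↔ ∃ k, U k = q := by simp [Fam]

lemma mem_Fam_succ {d p : ℕ} (U : Fin p → MvPolynomial (Fin d) ℝ) (a : ℕ) (q) :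
    q ∈ Fam U (a + 1) ↔ ∃ q' ∈ Fam U a, ∃ j, MvPolynomial.pderiv j q' = q := by
  simp [Fam]

lemma Fam_deg {d p : ℕ} (U : Fin p → MvPolynomial (Fin d) ℝ) :
    ∃ D : ℕ, ∀ a, ∀ q ∈ Fam U a, ∀ m, MvPolynomial.coeff m q ≠ 0 → m.degree + a ≤ D := by
  refine ⟨∑ k, (U k).totalDegree, fun a => ?_⟩
  induction a with
  | zero =>
    intro q hq m hm
    obtain ⟨k, rfl⟩ := (mem_Fam_zero U q).1 hq
    have h1 : m.degree ≤ (U k).totalDegree := 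
      MvPolynomial.le_totalDegree (MvPolynomial.mem_support_iff.2 hm)
    have h2 := Finset.single_le_sum (f := fun k => (U k).totalDegree) (fun i _ => Nat.zero_le _) (Finset.mem_univ k)
    simp at h2 ⊢
    omega
  | succ a ih =>
    intro q hq m hm
    obtain ⟨q', hq', j, rfl⟩ := (mem_Fam_succ U a q).1 hq
    rw [MvPolynomial.coeff_pderiv] at hm
    have := ih q' hq' _ (left_ne_zero_of_mul hm)
    rw [map_add, Finsupp.degree_single] at this
    omega

lemma Fam_zero {d p : ℕ} (U : Fin p → MvPolynomial (Fin d) ℝ) :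
    ∃ r : ℕ, ∀ a > r, ∀ q ∈ Fam U a, q = 0 := by
  obtain ⟨D, hD⟩ := Fam_deg U
  refine ⟨D, fun a ha q hq => ?_⟩
  ext m
  by_contra h
  have := hD a q hq m h
  omega

lemma Fam_nonvanish {d p : ℕ} (U : Fin p → MvPolynomial (Fin d) ℝ) (r : ℕ)
    (hr : ∀ a > r, ∀ q ∈ Fam U a, q = 0) (k : Fin p) (hk : U k ≠ 0) (x : Rd d) :
    ∃ a ∈ Finset.range (r + 1), ∃ q ∈ Fam U a, ev q x ≠ 0 := by
  by_contra hcon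
  push Not at hcon
  have key : ∀ n a, r + 1 ≤ a + n → ∀ q ∈ Fam U a, q = 0 := by
    intro n
    induction n with
    | zero => intro a ha; exact hr a (by omega)
    | succ n ih =>
      intro a ha q hq
      by_cases har : r < a
      · exact hr a har q hq
      have hx := hcon a (by simp; omega) q hq
      have hd : ∀ j, MvPolynomial.pderiv j q = 0 := fun j =>
        ih (a + 1) (by omega) _ ((mem_Fam_succ U a _).2 ⟨q, hq, j, rfl⟩)
      have hC : q = MvPolynomial.C (MvPolynomial.coeff 0 q) := by
        ext m
        rw [MvPolynomial.coeff_C]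
        split_ifs with h
        · rw [h]
        · obtain ⟨i, hi⟩ := Finsupp.ne_iff.1 (Ne.symm h)
          have h1 := MvPolynomial.coeff_pderiv (i := i) q (m - Finsupp.single i 1)
          rw [hd i, tsub_add_cancel_of_le] at h1
          · simp only [MvPolynomial.coeff_zero] at h1
            refine (mul_eq_zero.1 h1.symm).resolve_right ?_
            positivity
          · rw [Finsupp.single_le_iff]
            simp at hi
            omega
      rw [hC] at hx ⊢
      simp [ev] at hx
      simp [hx]
  exact hk (key (r + 1) 0 (by omega) _ ((mem_Fam_zero U _).2 ⟨k, rfl⟩))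

lemma cs_of {d : ℕ} {g v : Rd d → ℝ} (hv : HasCompactSupport v) (h : ∀ x, v x = 0 → g x = 0) :
    HasCompactSupport g :=
  hv.mono (fun x hx hvx => hx (h x hvx))

lemma integ {d : ℕ} {g v : Rd d → ℝ} (hg : ContDiff ℝ ∞ g) (hv : HasCompactSupport v)
    (h : ∀ x, v x = 0 → g x = 0) : Integrable g :=
  smooth_integrable hg (cs_of hv h)

/-- The potential. -/
def Vp {d p : ℕ} (U : Fin p → MvPolynomial (Fin d) ℝ) (x : Rd d) : ℝ := ∑ m, (ev (U m) x) ^ 2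

lemma Vp_smooth {d p : ℕ} (U : Fin p → MvPolynomial (Fin d) ℝ) : ContDiff ℝ ∞ (Vp U) :=
  ContDiff.sum fun m _ => (ev_smooth (U m)).pow 2

/-- The quadratic form. -/
def En {d p : ℕ} (U : Fin p → MvPolynomial (Fin d) ℝ) (v : Rd d → ℝ) : ℝ :=
  ∫ x, ((∑ j, (pdR j v x) ^ 2) + Vp U x * v x ^ 2)

lemma integ_En {d p : ℕ} (U : Fin p → MvPolynomial (Fin d) ℝ) {v : Rd d → ℝ}
    (hv : ContDiff ℝ ∞ v) (hc : HasCompactSupport v) :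
    Integrable (fun x => (∑ j, (pdR j v x) ^ 2) + Vp U x * v x ^ 2) := by
  apply Integrable.add
  · apply integrable_finsetSum
    intro j _
    exact integ ((pdR_smooth hv j).pow 2) (pdR_supp hc j) (fun x hx => by simp [hx])
  · exact integ ((Vp_smooth U).mul (hv.pow 2)) hc (fun x hx => by simp [hx])

lemma pt_ineq {A B C D L m δ z w : ℝ} (hB : |B| ≤ 1) (hC : |C| ≤ 1) (hD : |D| ≤ L)
    (hm : 0 ≤ m) (hδ : 0 < δ) :
    -(A * C * z ^ 2) - m * (A * B * D * z ^ 2) - 2 * (A * B * z * w) ≤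
      δ * z ^ 2 + ((1 + m * L) ^ 2 / (4 * δ) + 1) * (A ^ 2 * z ^ 2) + w ^ 2 := by
  have hL : 0 ≤ L := (abs_nonneg D).trans hD
  have h1 : -(A * C) ≤ |A| := by
    calc -(A * C) ≤ |A * C| := neg_le_abs _
      _ = |A| * |C| := abs_mul _ _
      _ ≤ |A| * 1 := by gcongr
      _ = |A| := mul_one _
  have h2 : -(A * B * D) ≤ |A| * L := by
    calc -(A * B * D) ≤ |A * B * D| := neg_le_abs _
      _ = |A| * |B| * |D| := by rw [abs_mul, abs_mul]
      _ ≤ |A| * 1 * L := by gcongr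
      _ = |A| * L := by ring
  have h3 : -(2 * (A * B * z * w)) ≤ A ^ 2 * z ^ 2 + w ^ 2 := by
    have : 0 ≤ (A * B * z + w) ^ 2 := sq_nonneg _
    have hB2 : B ^ 2 ≤ 1 := (sq_le_one_iff_abs_le_one B).2 hB
    nlinarith [mul_nonneg (mul_nonneg (sq_nonneg A) (sq_nonneg z)) (sub_nonneg.2 hB2)]
  have h4 : |A| * (1 + m * L) ≤ δ + (1 + m * L) ^ 2 / (4 * δ) * A ^ 2 := by
    have h0 : 0 ≤ (2 * δ - |A| * (1 + m * L)) ^ 2 / (4 * δ) := by positivity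
    have h5 : (2 * δ - |A| * (1 + m * L)) ^ 2 / (4 * δ) =
        δ - |A| * (1 + m * L) + (1 + m * L) ^ 2 / (4 * δ) * |A| ^ 2 := by
      field_simp; ring
    rw [sq_abs] at h5
    linarith
  have h6 : (-(A * C) - m * (A * B * D)) * z ^ 2 ≤ (δ + (1 + m * L) ^ 2 / (4 * δ) * A ^ 2) * z ^ 2 := by
    apply mul_le_mul_of_nonneg_right _ (sq_nonneg z)
    nlinarith [mul_le_mul_of_nonneg_left h2 hm]
  nlinarith

/-- The integration by parts step. -/
lemma ibp_step {d : ℕ} {σ : Rd d → ℝ} (hσ : ContDiff ℝ ∞ σ) (hpos : ∀ x, 0 < σ x) {L : ℝ}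
    (hL : ∀ j x, |pdR j σ x| ≤ L * σ x ^ 2) (a : ℕ) (j : Fin d) (q : Rd d → ℝ)
    (hq : ContDiff ℝ ∞ q)
    (h1 : ∀ x, |pdR j q x| ≤ σ x ^ (a + 2))
    (h2 : ∀ x, |pdR j (pdR j q) x| ≤ σ x ^ (a + 3)) {δ : ℝ} (hδ : 0 < δ)
    {v : Rd d → ℝ} (hv : ContDiff ℝ ∞ v) (hc : HasCompactSupport v) :
    ∫ x, (pdR j q x * (σ x)⁻¹ ^ (a + 2)) ^ 2 * (σ x * v x) ^ 2 ≤
      δ * (∫ x, (σ x * v x) ^ 2) +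
      ((1 + (2 * a + 2 : ℕ) * L) ^ 2 / (4 * δ) + 1) *
        (∫ x, (q x * (σ x)⁻¹ ^ (a + 1)) ^ 2 * (σ x * v x) ^ 2) +
      ∫ x, (pdR j v x) ^ 2 := by
  have hτ : ContDiff ℝ ∞ (fun y => (σ y)⁻¹) := hσ.inv (fun y => (hpos y).ne')
  have hdq := pdR_smooth hq j
  have hqq : ContDiff ℝ ∞ (fun y => q y * pdR j q y) := hq.mul hdq
  have hvv : ContDiff ℝ ∞ (fun y => v y ^ 2) := hv.pow 2
  have hττ : ContDiff ℝ ∞ (fun y => (fun z => (σ z)⁻¹) y ^ (2 * a + 2)) := hτ.pow _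
  have hqqτ : ContDiff ℝ ∞ (fun y => (fun y => q y * pdR j q y) y *
    (fun y => (fun z => (σ z)⁻¹) y ^ (2 * a + 2)) y) := hqq.mul hττ
  set g : Rd d → ℝ := fun y => (fun y => (fun y => q y * pdR j q y) y *
    (fun y => (fun z => (σ z)⁻¹) y ^ (2 * a + 2)) y) y * (fun y => v y ^ 2) y with hg
  have hgs : ContDiff ℝ ∞ g := hqqτ.mul hvv
  have hgc : HasCompactSupport g := cs_of hc (fun x hx => by simp [hg, hx])
  have hint := integral_pdR hgs hgc j
  have hσv : ContDiff ℝ ∞ (fun x => (σ x * v x) ^ 2) := (hσ.mul hv).pow 2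
  have i1 : Integrable (fun x => δ * (σ x * v x) ^ 2) :=
    (integ hσv hc (fun x hx => by simp [hx])).const_mul _
  have i2 : Integrable (fun x => ((1 + (2 * a + 2 : ℕ) * L) ^ 2 / (4 * δ) + 1) *
        ((q x * (σ x)⁻¹ ^ (a + 1)) ^ 2 * (σ x * v x) ^ 2)) :=
    (integ (((hq.mul (hτ.pow _)).pow 2).mul hσv) hc (fun x hx => by simp [hx])).const_mul _
  have i3 : Integrable (fun x => (pdR j v x) ^ 2) :=
    integ ((pdR_smooth hv j).pow 2) (pdR_supp hc j) (fun x hx => by simp [hx])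
  have i4 : Integrable (fun x => pdR j g x) := 
    smooth_integrable (pdR_smooth hgs j) (pdR_supp hgc j)
  have i0 : Integrable (fun x => (pdR j q x * (σ x)⁻¹ ^ (a + 2)) ^ 2 * (σ x * v x) ^ 2) :=
    integ (((hdq.mul (hτ.pow _)).pow 2).mul hσv) hc (fun x hx => by simp [hx])
  have hpt : ∀ x, (pdR j q x * (σ x)⁻¹ ^ (a + 2)) ^ 2 * (σ x * v x) ^ 2 ≤
      δ * (σ x * v x) ^ 2 + ((1 + (2 * a + 2 : ℕ) * L) ^ 2 / (4 * δ) + 1) *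
        ((q x * (σ x)⁻¹ ^ (a + 1)) ^ 2 * (σ x * v x) ^ 2) + (pdR j v x) ^ 2 + pdR j g x := by
    intro x
    have hs := hpos x
    have hb : ∀ (y : ℝ) (n : ℕ), |y| ≤ σ x ^ n → |y * (σ x)⁻¹ ^ n| ≤ 1 := by
      intro y n hy
      rw [abs_mul, abs_of_pos (by positivity : (0:ℝ) < (σ x)⁻¹ ^ n), inv_pow]
      rw [← div_eq_mul_inv, div_le_one (by positivity)]
      exact hy
    have hD : |pdR j (fun z => (σ z)⁻¹) x| ≤ L := by
      rw [pdR_inv hσ hpos, abs_div, abs_neg, abs_of_pos (by positivity : 0 < σ x ^ 2),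
        div_le_iff₀ (by positivity)]
      exact hL j x
    have hp := pt_ineq (A := q x * (σ x)⁻¹ ^ (a + 1)) (z := σ x * v x) (w := pdR j v x) (hb _ _ (h1 x)) (hb _ _ (h2 x)) hD
      (Nat.cast_nonneg (2 * a + 2)) hδ
    have hgx : pdR j g x = (pdR j q x * (σ x)⁻¹ ^ (a + 2)) ^ 2 * (σ x * v x) ^ 2
       + q x * (σ x)⁻¹ ^ (a + 1) * (pdR j (pdR j q) x * (σ x)⁻¹ ^ (a + 3)) * (σ x * v x) ^ 2
       + ((2 * a + 2 : ℕ) : ℝ) * (q x * (σ x)⁻¹ ^ (a + 1) * (pdR j q x * (σ x)⁻¹ ^ (a + 2)) *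
          pdR j (fun z => (σ z)⁻¹) x * (σ x * v x) ^ 2)
       + 2 * (q x * (σ x)⁻¹ ^ (a + 1) * (pdR j q x * (σ x)⁻¹ ^ (a + 2)) * (σ x * v x) * pdR j v x) := by
      rw [hg, pdR_mul hqqτ hvv, pdR_mul hqq hττ, pdR_mul hq hdq, pdR_pow hτ, pdR_pow hv]
      have hst : σ x * (σ x)⁻¹ = 1 := mul_inv_cancel₀ hs.ne'
      beta_reduce
      generalize (σ x)⁻¹ = τ at *
      generalize pdR j (fun z => (σ z)⁻¹) x = D at *
      simp only [Nat.add_succ_sub_one, Nat.cast_ofNat]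
      generalize σ x = s at *
      have e1 : τ ^ (2 * a + 2) = (τ ^ (a + 2)) ^ 2 * s ^ 2 := by
        have : (τ ^ (a + 2)) ^ 2 * s ^ 2 = τ ^ (2 * a + 2) * (s * τ) ^ 2 := by ring
        rw [this, hst]; ring
      have e1' : τ ^ (2 * a + 2) = τ ^ (a + 1) * τ ^ (a + 3) * s ^ 2 := by
        have : τ ^ (a + 1) * τ ^ (a + 3) * s ^ 2 = τ ^ (2 * a + 2) * (s * τ) ^ 2 := by ring
        rw [this, hst]; ring
      have e2 : τ ^ (2 * a + 1) = τ ^ (a + 1) * τ ^ (a + 2) * s ^ 2 := by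
        have : τ ^ (a + 1) * τ ^ (a + 2) * s ^ 2 = τ ^ (2 * a + 1) * (s * τ) ^ 2 := by ring
        rw [this, hst]; ring
      have e3 : τ ^ (2 * a + 2) = τ ^ (a + 1) * τ ^ (a + 2) * s := by
        have : τ ^ (a + 1) * τ ^ (a + 2) * s = τ ^ (2 * a + 2) * (s * τ) := by ring
        rw [this, hst]; ring
      rw [e2]
      have f1 : pdR j q x * pdR j q x * τ ^ (2 * a + 2) * v x ^ 2 =
        (pdR j q x * τ ^ (a + 2)) ^ 2 * (s * v x) ^ 2 := by rw [e1]; ring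
      have f2 : q x * pdR j (pdR j q) x * τ ^ (2 * a + 2) * v x ^ 2 =
        q x * τ ^ (a + 1) * (pdR j (pdR j q) x * τ ^ (a + 3)) * (s * v x) ^ 2 := by rw [e1']; ring
      have f3 : q x * pdR j q x * τ ^ (2 * a + 2) * (2 * v x * pdR j v x) =
        2 * (q x * τ ^ (a + 1) * (pdR j q x * τ ^ (a + 2)) * (s * v x) * pdR j v x) := by
        rw [e3]; ring
      rw [← f1, ← f2, ← f3]
      ring
    linarith
  have := integral_mono i0 (((i1.add i2).add i3).add i4) hpt
  simp only [Pi.add_apply] at this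
  have e1 := integral_add ((i1.add i2).add i3) i4
  have e2 := integral_add (i1.add i2) i3
  have e3 := integral_add i1 i2
  simp only [Pi.add_apply] at e1 e2 e3
  rw [e1, e2, e3, hint, integral_const_mul, integral_const_mul] at this
  linarith

lemma form_ind {d p : ℕ} (U : Fin p → MvPolynomial (Fin d) ℝ) 
    {σ : Rd d → ℝ} (hσ : ContDiff ℝ ∞ σ) (hpos : ∀ x, 0 < σ x) {L : ℝ}
    (hL : ∀ j x, |pdR j σ x| ≤ L * σ x ^ 2)
    (hq : ∀ a, ∀ q ∈ Fam U a, ∀ x, |ev q x| ≤ σ x ^ (a + 1)) (a : ℕ) :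
    ∀ δ > 0, ∃ C ≥ 0, ∀ q ∈ Fam U a, ∀ v : Rd d → ℝ, ContDiff ℝ ∞ v → HasCompactSupport v →
      ∫ x, (ev q x * (σ x)⁻¹ ^ (a + 1)) ^ 2 * (σ x * v x) ^ 2 ≤
        δ * (∫ x, (σ x * v x) ^ 2) + C * En U v := by
  induction a with
  | zero =>
    intro δ hδ
    refine ⟨1, zero_le_one, fun q hqF v hv hc => ?_⟩
    obtain ⟨k, rfl⟩ := (mem_Fam_zero U q).1 hqF
    have hn : 0 ≤ δ * (∫ x, (σ x * v x) ^ 2) :=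
      mul_nonneg hδ.le (integral_nonneg (fun x => sq_nonneg _))
    have hτ : ContDiff ℝ ∞ (fun y => (σ y)⁻¹) := hσ.inv (fun y => (hpos y).ne')
    have : ∫ x, (ev (U k) x * (σ x)⁻¹ ^ (0 + 1)) ^ 2 * (σ x * v x) ^ 2 ≤ En U v := by
      apply integral_mono _ (integ_En U hv hc)
      · intro x
        have hs := (hpos x).ne'
        have h1 : (ev (U k) x * (σ x)⁻¹ ^ (0 + 1)) ^ 2 * (σ x * v x) ^ 2 = ev (U k) x ^ 2 * v x ^ 2 := by
          rw [zero_add, pow_one]; field_simp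
        have h2 : ev (U k) x ^ 2 ≤ Vp U x :=
          Finset.single_le_sum (f := fun m => ev (U m) x ^ 2) (fun i _ => sq_nonneg _) (Finset.mem_univ k)
        have h3 : 0 ≤ ∑ j, (pdR j v x) ^ 2 := Finset.sum_nonneg (fun j _ => sq_nonneg _)
        simp only [h1]
        have := mul_le_mul_of_nonneg_right h2 (sq_nonneg (v x))
        linarith
      · exact integ ((((ev_smooth _).mul (hτ.pow _)).pow 2).mul ((hσ.mul hv).pow 2)) hc
          (fun x hx => by simp [hx])
    linarith
  | succ a ih =>
    intro δ hδ
    set K : ℝ := ((1 + (2 * a + 2 : ℕ) * L) ^ 2 / (4 * (δ / 2)) + 1) with hK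
    have hKpos : 0 < K := by positivity
    obtain ⟨C, hC, hh⟩ := ih (δ / (2 * K)) (by positivity)
    refine ⟨K * C + 1, by positivity, fun q hqF v hv hc => ?_⟩
    obtain ⟨q', hq', j, rfl⟩ := (mem_Fam_succ U a q).1 hqF
    have h0 := ibp_step hσ hpos hL a j (ev q') (ev_smooth q')
      (by rw [pdR_ev]; exact hq (a + 1) _ hqF)
      (by rw [pdR_ev, pdR_ev]; exact hq (a + 2) _ ((mem_Fam_succ U _ _).2 ⟨_, hqF, j, rfl⟩))
      (half_pos hδ) hv hc
    rw [pdR_ev, ← hK] at h0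
    have h1 := mul_le_mul_of_nonneg_left (hh q' hq' v hv hc) hKpos.le
    have h2 : ∫ x, (pdR j v x) ^ 2 ≤ En U v := by
      apply integral_mono _ (integ_En U hv hc)
      · intro x
        have h1 : (pdR j v x) ^ 2 ≤ ∑ j, (pdR j v x) ^ 2 :=
          Finset.single_le_sum (f := fun m => (pdR m v x) ^ 2) (fun i _ => sq_nonneg _) (Finset.mem_univ j)
        have h2 : 0 ≤ Vp U x := Finset.sum_nonneg (fun j _ => sq_nonneg _)
        have := mul_nonneg h2 (sq_nonneg (v x))
        simp only
        linarith
      · exact integ ((pdR_smooth hv j).pow 2) (pdR_supp hc j) (fun x hx => by simp [hx])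
    have h3 : K * (δ / (2 * K) * (∫ x, (σ x * v x) ^ 2) + C * En U v) =
        δ / 2 * (∫ x, (σ x * v x) ^ 2) + K * C * En U v := by
      field_simp
    rw [h3] at h1
    linarith

lemma form_est {d p : ℕ} (U : Fin p → MvPolynomial (Fin d) ℝ) 
    {σ : Rd d → ℝ} (hσ : ContDiff ℝ ∞ σ) (hpos : ∀ x, 0 < σ x) {L : ℝ}
    (hL : ∀ j x, |pdR j σ x| ≤ L * σ x ^ 2)
    (hq : ∀ a, ∀ q ∈ Fam U a, ∀ x, |ev q x| ≤ σ x ^ (a + 1)) (r : ℕ)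
    (hS : ∀ x, 1 ≤ ∑ a ∈ Finset.range (r + 1), ∑ q ∈ Fam U a, (ev q x * (σ x)⁻¹ ^ (a + 1)) ^ 2) :
    ∃ C ≥ 0, ∀ v : Rd d → ℝ, ContDiff ℝ ∞ v → HasCompactSupport v →
      ∫ x, (σ x * v x) ^ 2 ≤ C * En U v := by
  obtain ⟨M, hM⟩ : ∃ M : ℝ, M = ∑ a ∈ Finset.range (r + 1), ∑ q ∈ Fam U a, (1:ℝ) := ⟨_, rfl⟩
  have hM0 : 0 ≤ M := hM ▸ Finset.sum_nonneg fun a _ => Finset.sum_nonneg fun q _ => zero_le_one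
  have hδ : 0 < 1 / (2 * (M + 1)) := by positivity
  choose C hC hh using fun a => form_ind U hσ hpos hL hq a _ hδ
  have hτ : ContDiff ℝ ∞ (fun y => (σ y)⁻¹) := hσ.inv (fun y => (hpos y).ne')
  refine ⟨2 * ∑ a ∈ Finset.range (r + 1), ∑ q ∈ Fam U a, C a, ?_, fun v hv hc => ?_⟩
  · exact mul_nonneg zero_le_two (Finset.sum_nonneg fun a _ => Finset.sum_nonneg fun q _ => hC a)
  have ia : ∀ a q, Integrable (fun x => (ev q x * (σ x)⁻¹ ^ (a + 1)) ^ 2 * (σ x * v x) ^ 2) := fun a q =>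
    integ ((((ev_smooth _).mul (hτ.pow _)).pow 2).mul ((hσ.mul hv).pow 2)) hc (fun x hx => by simp [hx])
  have h1 : ∫ x, (σ x * v x) ^ 2 ≤ ∫ x, ∑ a ∈ Finset.range (r + 1), ∑ q ∈ Fam U a,
      (ev q x * (σ x)⁻¹ ^ (a + 1)) ^ 2 * (σ x * v x) ^ 2 := by
    apply integral_mono
    · exact integ ((hσ.mul hv).pow 2) hc (fun x hx => by simp [hx])
    · exact integrable_finsetSum _ fun a _ => integrable_finsetSum _ fun q _ => ia a q
    · intro x
      have := mul_le_mul_of_nonneg_right (hS x) (sq_nonneg (σ x * v x))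
      simp only [Finset.sum_mul, one_mul] at this
      exact this
  rw [integral_finsetSum _ fun a _ => integrable_finsetSum _ fun q _ => ia a q] at h1
  have h2 : ∑ a ∈ Finset.range (r + 1), ∫ x, ∑ q ∈ Fam U a,
      (ev q x * (σ x)⁻¹ ^ (a + 1)) ^ 2 * (σ x * v x) ^ 2 ≤
      ∑ a ∈ Finset.range (r + 1), ∑ q ∈ Fam U a, 
        (1 / (2 * (M + 1)) * (∫ x, (σ x * v x) ^ 2) + C a * En U v) := by
    apply Finset.sum_le_sum
    intro a _
    rw [integral_finsetSum _ fun q _ => ia a q]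
    exact Finset.sum_le_sum fun q hqF => hh a q hqF v hv hc
  have h3 : ∑ a ∈ Finset.range (r + 1), ∑ q ∈ Fam U a, 
        (1 / (2 * (M + 1)) * (∫ x, (σ x * v x) ^ 2) + C a * En U v) =
      M * (1 / (2 * (M + 1)) * (∫ x, (σ x * v x) ^ 2)) +
      (∑ a ∈ Finset.range (r + 1), ∑ q ∈ Fam U a, C a) * En U v := by
    simp only [hM, Finset.sum_add_distrib, Finset.sum_mul, one_mul]
  have h4 : M * (1 / (2 * (M + 1)) * (∫ x, (σ x * v x) ^ 2)) ≤ 1 / 2 * ∫ x, (σ x * v x) ^ 2 := by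
    rw [← mul_assoc]
    apply mul_le_mul_of_nonneg_right _ (integral_nonneg fun x => sq_nonneg _)
    rw [mul_one_div, div_le_div_iff₀ (by positivity) (by positivity)]
    linarith
  linarith

/-- Exponents. -/
def exN (r a : ℕ) : ℕ := (r + 1).factorial / (a + 1)

lemma exN_mul {r a : ℕ} (h : a ∈ Finset.range (r + 1)) :
    (a + 1) * exN r a = (r + 1).factorial := by
  rw [Finset.mem_range] at h
  exact Nat.mul_div_cancel' (Nat.dvd_factorial (by omega) (by omega))

lemma exN_pos {r a : ℕ} (h : a ∈ Finset.range (r + 1)) : 1 ≤ exN r a := by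
  have h1 := exN_mul h
  have h2 := (r + 1).factorial_pos
  rcases Nat.eq_zero_or_pos (exN r a) with h3 | h3
  · rw [h3] at h1; omega
  · exact h3

def Sf {d p : ℕ} (U : Fin p → MvPolynomial (Fin d) ℝ) (r : ℕ) (c : ℝ) (x : Rd d) : ℝ :=
  ∑ a ∈ Finset.range (r + 1), ∑ q ∈ Fam U a, (ev q x / c) ^ (2 * exN r a)

def sig {d p : ℕ} (U : Fin p → MvPolynomial (Fin d) ℝ) (r : ℕ) (c : ℝ) (x : Rd d) : ℝ :=
  (Sf U r c x) ^ (((2 * (r + 1).factorial : ℕ) : ℝ)⁻¹)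

lemma Sf_term_smooth {d : ℕ} (q : MvPolynomial (Fin d) ℝ) (c : ℝ) (n : ℕ) :
    ContDiff ℝ ∞ (fun x : Rd d => (ev q x / c) ^ n) := ((ev_smooth q).div_const c).pow n

lemma Sf_smooth {d p : ℕ} (U : Fin p → MvPolynomial (Fin d) ℝ) (r : ℕ) (c : ℝ) :
    ContDiff ℝ ∞ (Sf U r c) :=
  ContDiff.sum fun _ _ => ContDiff.sum fun q _ => Sf_term_smooth q c _

lemma Sf_le {d p : ℕ} (U : Fin p → MvPolynomial (Fin d) ℝ) (r : ℕ) (c : ℝ) (x : Rd d) {a : ℕ}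
    (ha : a ∈ Finset.range (r + 1)) {q} (hq : q ∈ Fam U a) :
    (ev q x / c) ^ (2 * exN r a) ≤ Sf U r c x := by
  have hn : ∀ (a : ℕ) (q : MvPolynomial (Fin d) ℝ), 0 ≤ (ev q x / c) ^ (2 * exN r a) := fun a q => by
    rw [pow_mul]; positivity
  calc (ev q x / c) ^ (2 * exN r a) ≤ ∑ q ∈ Fam U a, (ev q x / c) ^ (2 * exN r a) :=
        Finset.single_le_sum (f := fun q => (ev q x / c) ^ (2 * exN r a)) (fun q _ => hn a q) hq
    _ ≤ Sf U r c x :=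
        Finset.single_le_sum (f := fun a => ∑ q ∈ Fam U a, (ev q x / c) ^ (2 * exN r a))
          (fun a _ => Finset.sum_nonneg fun q _ => hn a q) ha


lemma Sf_pos {d p : ℕ} (U : Fin p → MvPolynomial (Fin d) ℝ) (r : ℕ)
    (hr : ∀ a > r, ∀ q ∈ Fam U a, q = 0) (k : Fin p) (hk : U k ≠ 0) {c : ℝ} (hc : 0 < c) (x : Rd d) : 0 < Sf U r c x := by
  obtain ⟨a, ha, q, hq, h⟩ := Fam_nonvanish U r hr k hk x
  refine lt_of_lt_of_le ?_ (Sf_le U r c x ha hq)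
  rw [pow_mul]
  have : ev q x / c ≠ 0 := div_ne_zero h hc.ne'
  positivity

lemma sig_pos {d p : ℕ} (U : Fin p → MvPolynomial (Fin d) ℝ) (r : ℕ)
    (hr : ∀ a > r, ∀ q ∈ Fam U a, q = 0) (k : Fin p) (hk : U k ≠ 0) {c : ℝ} (hc : 0 < c) (x : Rd d) : 0 < sig U r c x := Real.rpow_pos_of_pos (Sf_pos U r hr k hk hc x) _

lemma sig_smooth {d p : ℕ} (U : Fin p → MvPolynomial (Fin d) ℝ) (r : ℕ)
    (hr : ∀ a > r, ∀ q ∈ Fam U a, q = 0) (k : Fin p) (hk : U k ≠ 0) {c : ℝ} (hc : 0 < c) : ContDiff ℝ ∞ (sig U r c) :=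
  (Sf_smooth U r c).rpow_const_of_ne fun x => (Sf_pos U r hr k hk hc x).ne'

lemma sig_pow {d p : ℕ} (U : Fin p → MvPolynomial (Fin d) ℝ) (r : ℕ)
    (hr : ∀ a > r, ∀ q ∈ Fam U a, q = 0) (k : Fin p) (hk : U k ≠ 0) {c : ℝ} (hc : 0 < c) (x : Rd d) : sig U r c x ^ (2 * (r + 1).factorial) = Sf U r c x := by
  unfold sig
  apply Real.rpow_inv_natCast_pow (Sf_pos U r hr k hk hc x).le
  have := (r + 1).factorial_pos
  omega

lemma sig_bound {d p : ℕ} (U : Fin p → MvPolynomial (Fin d) ℝ) (r : ℕ)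
    (hr : ∀ a > r, ∀ q ∈ Fam U a, q = 0) (k : Fin p) (hk : U k ≠ 0) {c : ℝ} (hc : 0 < c) (a : ℕ) (q) (hq : q ∈ Fam U a) (x : Rd d) :
    |ev q x / c| ≤ sig U r c x ^ (a + 1) := by
  have hs := sig_pos U r hr k hk hc x
  by_cases ha : a ∈ Finset.range (r + 1)
  · have h1 := Sf_le U r c x ha hq
    rw [← sig_pow U r hr k hk hc, ← exN_mul ha] at h1
    have h2 : sig U r c x ^ (2 * ((a + 1) * exN r a)) = (sig U r c x ^ (a + 1)) ^ (2 * exN r a) := by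
      rw [← pow_mul]; congr 1; ring
    have h3 : (ev q x / c) ^ (2 * exN r a) = |ev q x / c| ^ (2 * exN r a) := by
      rw [pow_mul, pow_mul, sq_abs]
    rw [h2, h3] at h1
    have := exN_pos ha
    exact (pow_le_pow_iff_left₀ (abs_nonneg _) (by positivity) (by omega)).1 h1
  · rw [hr a (by simpa using ha) q hq]
    simp [ev]
    positivity

lemma sig_deriv {d p : ℕ} (U : Fin p → MvPolynomial (Fin d) ℝ) (r : ℕ)
    (hr : ∀ a > r, ∀ q ∈ Fam U a, q = 0) (k : Fin p) (hk : U k ≠ 0) {c : ℝ} (hc : 0 < c) (j : Fin d) (x : Rd d) :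
    |pdR j (sig U r c) x| ≤
      (∑ a ∈ Finset.range (r + 1), ∑ q ∈ Fam U a, (2 * exN r a : ℕ) : ℝ) * sig U r c x ^ 2 := by
  have hs := sig_pos U r hr k hk hc x
  have h1 : (fun y => sig U r c y ^ (2 * (r + 1).factorial)) = Sf U r c :=
    funext (sig_pow U r hr k hk hc)
  have hN := (r + 1).factorial_pos
  have h2 := pdR_pow (sig_smooth U r hr k hk hc) (2 * (r + 1).factorial) j x
  rw [h1] at h2
  have h3 : pdR j (Sf U r c) x = ∑ a ∈ Finset.range (r + 1), ∑ q ∈ Fam U a,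
      ((2 * exN r a : ℕ) : ℝ) * (ev q x / c) ^ (2 * exN r a - 1) *
        (ev (MvPolynomial.pderiv j q) x / c) := by
    unfold Sf
    rw [pdR_sum _ (fun _ _ => ContDiff.sum fun q _ => Sf_term_smooth q c _)]
    refine Finset.sum_congr rfl fun a _ => ?_
    rw [pdR_sum _ (fun q _ => Sf_term_smooth q c _)]
    refine Finset.sum_congr rfl fun q _ => ?_
    rw [pdR_pow ((ev_smooth q).div_const c), pdR_div_const (ev_smooth q), pdR_ev]
  set s := sig U r c x with hsdef
  have h4 : |pdR j (Sf U r c) x| ≤ ∑ a ∈ Finset.range (r + 1), ∑ q ∈ Fam U a,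
      ((2 * exN r a : ℕ) : ℝ) * s ^ (2 * (r + 1).factorial + 1) := by
    rw [h3]
    refine (Finset.abs_sum_le_sum_abs _ _).trans (Finset.sum_le_sum fun a ha => ?_)
    refine (Finset.abs_sum_le_sum_abs _ _).trans (Finset.sum_le_sum fun q hq => ?_)
    rw [abs_mul, abs_mul, abs_pow, Nat.abs_cast, mul_assoc]
    apply mul_le_mul_of_nonneg_left _ (Nat.cast_nonneg _)
    have b1 := sig_bound U r hr k hk hc a q hq x
    have b2 := sig_bound U r hr k hk hc (a + 1) _ ((mem_Fam_succ U a _).2 ⟨q, hq, j, rfl⟩) x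
    rw [← hsdef] at b1 b2
    calc |ev q x / c| ^ (2 * exN r a - 1) * |ev (MvPolynomial.pderiv j q) x / c|
        ≤ (s ^ (a + 1)) ^ (2 * exN r a - 1) * s ^ (a + 1 + 1) := by gcongr
      _ = s ^ (2 * (r + 1).factorial + 1) := by
        rw [← pow_mul, ← pow_add]
        congr 1
        have e1 := exN_mul ha
        have e2 := exN_pos ha
        obtain ⟨m, hm⟩ : ∃ m, exN r a = m + 1 := ⟨exN r a - 1, by omega⟩
        rw [← e1, hm]
        have : 2 * (m + 1) - 1 = 2 * m + 1 := by omega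
        rw [this]
        ring
  rw [h2] at h4
  simp only [← Finset.sum_mul] at h4
  set L : ℝ := (∑ a ∈ Finset.range (r + 1), ∑ q ∈ Fam U a, ((2 * exN r a : ℕ) : ℝ)) with hLdef
  rw [abs_mul, abs_mul, Nat.abs_cast, abs_of_pos (by positivity : 0 < s ^ (2 * (r + 1).factorial - 1))] at h4
  have h5 : s ^ (2 * (r + 1).factorial + 1) = s ^ (2 * (r + 1).factorial - 1) * s ^ 2 := by
    rw [← pow_add]; congr 1; omega
  have h6 : (1:ℝ) ≤ (2 * (r + 1).factorial : ℕ) := by exact_mod_cast (by omega)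
  have h7 : s ^ (2 * (r + 1).factorial - 1) * |pdR j (sig U r c) x| ≤
      s ^ (2 * (r + 1).factorial - 1) * (L * s ^ 2) := by
    calc _ = 1 * s ^ (2 * (r + 1).factorial - 1) * |pdR j (sig U r c) x| := by ring
      _ ≤ (2 * (r + 1).factorial : ℕ) * s ^ (2 * (r + 1).factorial - 1) * |pdR j (sig U r c) x| := by
        gcongr
      _ ≤ _ := h4
      _ = _ := by rw [h5]; ring
  exact le_of_mul_le_mul_left h7 (by positivity)


lemma sig_lower {d p : ℕ} (U : Fin p → MvPolynomial (Fin d) ℝ) (r : ℕ)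
    (hr : ∀ a > r, ∀ q ∈ Fam U a, q = 0) (k : Fin p) (hk : U k ≠ 0) (x : Rd d) :
    1 ≤ ∑ a ∈ Finset.range (r + 1), ∑ q ∈ Fam U a, (ev q x * (sig U r 1 x)⁻¹ ^ (a + 1)) ^ 2 := by
  have hs := sig_pos U r hr k hk one_pos x
  have h1 := sig_pow U r hr k hk one_pos x
  have h2 : (1:ℝ) = Sf U r 1 x * (sig U r 1 x)⁻¹ ^ (2 * (r + 1).factorial) := by
    rw [← h1, inv_pow, mul_inv_cancel₀ (by positivity)]
  refine h2.le.trans ?_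
  unfold Sf
  simp only [Finset.sum_mul]
  refine Finset.sum_le_sum fun a ha => Finset.sum_le_sum fun q hq => ?_
  have hb := sig_bound U r hr k hk one_pos a q hq x
  have e : (ev q x / 1) ^ (2 * exN r a) * (sig U r 1 x)⁻¹ ^ (2 * (r + 1).factorial) =
      ((ev q x * (sig U r 1 x)⁻¹ ^ (a + 1)) ^ 2) ^ exN r a := by
    rw [div_one, ← exN_mul ha, ← pow_mul, mul_pow, ← pow_mul]
    congr 2
    ring
  rw [e]
  apply pow_le_of_le_one (sq_nonneg _) _ (by have := exN_pos ha; omega)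
  rw [sq_le_one_iff_abs_le_one, abs_mul, abs_of_pos (by positivity : 0 < (sig U r 1 x)⁻¹ ^ (a + 1)),
    inv_pow, ← div_eq_mul_inv, div_le_one (by positivity)]
  simpa using hb

lemma sig_scale {d p : ℕ} (U : Fin p → MvPolynomial (Fin d) ℝ) (r : ℕ)
    (hr : ∀ a > r, ∀ q ∈ Fam U a, q = 0) (k : Fin p) (hk : U k ≠ 0) {t : ℝ} (ht : 1 ≤ t) (x : Rd d) :
    t * sig U r (t ^ (r + 1)) x ≤ sig U r 1 x := by
  have ht0 : 0 < t := by linarith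
  have hs1 := sig_pos U r hr k hk one_pos x
  have hst := sig_pos U r hr k hk (c := t ^ (r + 1)) (by positivity) x
  have hN := (r + 1).factorial_pos
  refine (pow_le_pow_iff_left₀ (n := 2 * (r + 1).factorial) (by positivity) hs1.le (by omega)).1 ?_
  rw [mul_pow, sig_pow U r hr k hk one_pos, sig_pow U r hr k hk (by positivity)]
  unfold Sf
  simp only [Finset.mul_sum]
  refine Finset.sum_le_sum fun a ha => Finset.sum_le_sum fun q hq => ?_
  rw [div_pow, div_one, ← mul_div_assoc, div_le_iff₀ (by positivity), mul_comm]
  apply mul_le_mul_of_nonneg_left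
  · rw [← pow_mul]
    apply pow_le_pow_right₀ ht
    rw [← exN_mul ha]
    have : a + 1 ≤ r + 1 := by simp at ha; omega
    nlinarith [Nat.mul_le_mul_right (exN r a) this]
  · rw [pow_mul]; positivity

/-- The operator `-Δ + U` on real functions. -/
def PR {d p : ℕ} (U : Fin p → MvPolynomial (Fin d) ℝ) (u : Rd d → ℝ) (x : Rd d) : ℝ :=
  -(∑ j, pdR j (pdR j u) x) + Vp U x * u x

lemma lap_smooth {d : ℕ} {u : Rd d → ℝ} (hu : ContDiff ℝ ∞ u) :
    ContDiff ℝ ∞ (fun x => ∑ j, pdR j (pdR j u) x) :=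
  ContDiff.sum fun j _ => pdR_smooth (pdR_smooth hu j) j

lemma PR_smooth {d p : ℕ} (U : Fin p → MvPolynomial (Fin d) ℝ) {u : Rd d → ℝ}
    (hu : ContDiff ℝ ∞ u) : ContDiff ℝ ∞ (PR U u) :=
  (lap_smooth hu).neg.add ((Vp_smooth U).mul hu)

lemma pdR_zero_of {d : ℕ} {f : Rd d → ℝ} {x : Rd d} (hx : x ∉ tsupport f) (j : Fin d) :
    pdR j f x = 0 := by
  unfold pdR
  rw [fderiv_of_notMem_tsupport ℝ hx]; rfl

lemma pdR_tsupport {d : ℕ} (f : Rd d → ℝ) (j : Fin d) : tsupport (pdR j f) ⊆ tsupport f := by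
  apply closure_minimal _ (isClosed_tsupport f)
  intro x hx
  by_contra h
  exact hx (pdR_zero_of h j)

lemma integ' {d : ℕ} {g u : Rd d → ℝ} (hg : ContDiff ℝ ∞ g) (hu : HasCompactSupport u)
    (h : ∀ x, x ∉ tsupport u → g x = 0) : Integrable g :=
  smooth_integrable hg (HasCompactSupport.intro hu h)

lemma lap_zero {d : ℕ} {u : Rd d → ℝ} {x : Rd d} (hx : x ∉ tsupport u) :
    ∑ j, pdR j (pdR j u) x = 0 :=
  Finset.sum_eq_zero fun j _ => pdR_zero_of (fun h => hx (pdR_tsupport u j h)) j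

lemma PR_zero {d p : ℕ} (U : Fin p → MvPolynomial (Fin d) ℝ) {u : Rd d → ℝ} {x : Rd d}
    (hx : x ∉ tsupport u) : PR U u x = 0 := by
  simp [PR, lap_zero hx, image_eq_zero_of_notMem_tsupport hx]

lemma En_sigma {d p : ℕ} (U : Fin p → MvPolynomial (Fin d) ℝ) {σ : Rd d → ℝ}
    (hσ : ContDiff ℝ ∞ σ) {L : ℝ} (hL : ∀ j x, |pdR j σ x| ≤ L * σ x ^ 2)
    {u : Rd d → ℝ} (hu : ContDiff ℝ ∞ u) (hc : HasCompactSupport u) :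
    En U (fun x => σ x * u x) ≤
      (d * L ^ 2 + 1 / 4) * (∫ x, (σ x * (σ x * u x)) ^ 2) + ∫ x, (PR U u x) ^ 2 := by
  have hv : ContDiff ℝ ∞ (fun x => σ x * u x) := hσ.mul hu
  have hvc : HasCompactSupport (fun x => σ x * u x) := cs_of hc (fun x hx => by simp [hx])
  have hs2 : ContDiff ℝ ∞ (fun y => σ y ^ 2) := hσ.pow 2
  have hud : ∀ j, ContDiff ℝ ∞ (fun y => u y * pdR j u y) := fun j => hu.mul (pdR_smooth hu j)
  set g : Fin d → Rd d → ℝ := fun j y => (fun y => σ y ^ 2) y * (fun y => u y * pdR j u y) y with hg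
  have hgs : ∀ j, ContDiff ℝ ∞ (g j) := fun j => hs2.mul (hud j)
  have hgc : ∀ j, HasCompactSupport (g j) := fun j => cs_of hc (fun x hx => by simp [hg, hx])
  have i1 : Integrable (fun x => (d * L ^ 2 + 1 / 4) * (σ x * (σ x * u x)) ^ 2) :=
    (integ ((hσ.mul hv).pow 2) hc (fun x hx => by simp [hx])).const_mul _
  have i2 : Integrable (fun x => (PR U u x) ^ 2) :=
    integ' ((PR_smooth U hu).pow 2) hc (fun x hx => by simp [PR_zero U hx])
  have i3' : ∀ j, Integrable (fun x => pdR j (g j) x) := fun j =>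
    smooth_integrable (pdR_smooth (hgs j) j) (pdR_supp (hgc j) j)
  have i3 : Integrable (fun x => ∑ j, pdR j (g j) x) := integrable_finsetSum _ fun j _ => i3' j
  have hpt : ∀ x, (∑ j, (pdR j (fun x => σ x * u x) x) ^ 2) + Vp U x * (σ x * u x) ^ 2 ≤
      (d * L ^ 2 + 1 / 4) * (σ x * (σ x * u x)) ^ 2 + (PR U u x) ^ 2 + ∑ j, pdR j (g j) x := by
    intro x
    have e1 : ∀ j, (pdR j (fun x => σ x * u x) x) ^ 2 = (pdR j σ x) ^ 2 * u x ^ 2 +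
        pdR j (g j) x - σ x ^ 2 * u x * pdR j (pdR j u) x := by
      intro j
      rw [hg, pdR_mul hs2 (hud j), pdR_mul hu (pdR_smooth hu j), pdR_pow hσ, pdR_mul hσ hu]
      simp only [Nat.add_one_sub_one, pow_one, Nat.cast_ofNat]
      ring
    have e2 : ∀ j, (pdR j σ x) ^ 2 * u x ^ 2 ≤ L ^ 2 * (σ x * (σ x * u x)) ^ 2 := by
      intro j
      have h1 : (pdR j σ x) ^ 2 ≤ (L * σ x ^ 2) ^ 2 := by
        rw [← sq_abs]; gcongr; exact hL j x
      calc (pdR j σ x) ^ 2 * u x ^ 2 ≤ (L * σ x ^ 2) ^ 2 * u x ^ 2 := by gcongr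
        _ = _ := by ring
    have e3 : ∑ j : Fin d, (pdR j σ x) ^ 2 * u x ^ 2 ≤ d * (L ^ 2 * (σ x * (σ x * u x)) ^ 2) := by
      calc _ ≤ ∑ j : Fin d, L ^ 2 * (σ x * (σ x * u x)) ^ 2 := Finset.sum_le_sum fun j _ => e2 j
        _ = _ := by simp
    simp only [e1, Finset.sum_add_distrib, Finset.sum_sub_distrib, ← Finset.mul_sum]
    have e4 : - (σ x ^ 2 * u x * ∑ j, pdR j (pdR j u) x) + Vp U x * (σ x * u x) ^ 2 =
        (σ x * (σ x * u x)) * PR U u x := by unfold PR; ring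
    nlinarith [sq_nonneg (1 / 2 * (σ x * (σ x * u x)) - PR U u x)]
  have := integral_mono (integ_En U hv hvc) ((i1.add i2).add i3) hpt
  have f1 := integral_add (i1.add i2) i3
  have f2 := integral_add i1 i2
  have f3 : ∫ x, ∑ j, pdR j (g j) x = 0 := by
    rw [integral_finsetSum _ fun j _ => i3' j]
    exact Finset.sum_eq_zero fun j _ => integral_pdR (hgs j) (hgc j) j
  simp only [Pi.add_apply] at f1 f2 this
  rw [f1, f2, f3, integral_const_mul] at this
  unfold En
  linarith

lemma max_est_ne {d p : ℕ} (U : Fin p → MvPolynomial (Fin d) ℝ) (k : Fin p) (hk : U k ≠ 0) :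
    ∃ C ≥ 0, ∀ u : Rd d → ℝ, ContDiff ℝ ∞ u → HasCompactSupport u →
      ∫ x, (Vp U x * u x) ^ 2 ≤ C * ∫ x, (PR U u x) ^ 2 := by
  obtain ⟨r, hr⟩ := Fam_zero U
  obtain ⟨L, hLdef⟩ : ∃ L : ℝ, L = ∑ a ∈ Finset.range (r + 1), ∑ q ∈ Fam U a, ((2 * exN r a : ℕ) : ℝ) :=
    ⟨_, rfl⟩
  have hL : ∀ c : ℝ, 0 < c → ∀ j x, |pdR j (sig U r c) x| ≤ L * sig U r c x ^ 2 := by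
    intro c hc j x
    rw [hLdef]
    exact sig_deriv U r hr k hk hc j x
  obtain ⟨C, hC, hform⟩ := form_est U (sig_smooth U r hr k hk one_pos) (sig_pos U r hr k hk one_pos)
    (hL 1 one_pos) (fun a q hq x => by simpa using sig_bound U r hr k hk one_pos a q hq x) r
    (sig_lower U r hr k hk)
  obtain ⟨t, ht⟩ : ∃ t : ℝ, t = 4 * (C + 1) * (d * L ^ 2 + 1) := ⟨_, rfl⟩
  have hdL : 0 ≤ (d:ℝ) * L ^ 2 := by positivity
  have hCd : 0 ≤ C * (d * L ^ 2) := mul_nonneg hC hdL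
  have ht1 : 1 ≤ t := by rw [ht]; nlinarith
  have htt : t ≤ t ^ 2 := by nlinarith
  have hcpos : 0 < t ^ (r + 1) := by positivity
  set c := t ^ (r + 1) with hcdef
  refine ⟨(p * c ^ 2) ^ 2 * 2, by positivity, fun u hu huc => ?_⟩
  have hσ := sig_smooth U r hr k hk hcpos
  set σ := sig U r c with hσdef
  have hv : ContDiff ℝ ∞ (fun x => σ x * u x) := hσ.mul hu
  have hvc : HasCompactSupport (fun x => σ x * u x) := cs_of huc (fun x hx => by simp [hx])
  have h1 := hform _ hv hvc
  have h2 := En_sigma U hσ (hL c hcpos) hu huc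
  set X := ∫ x, (σ x * (σ x * u x)) ^ 2 with hX
  set N := ∫ x, (PR U u x) ^ 2 with hN
  have iX : Integrable (fun x => (σ x * (σ x * u x)) ^ 2) :=
    integ ((hσ.mul hv).pow 2) huc (fun x hx => by simp [hx])
  have hX0 : 0 ≤ X := integral_nonneg fun x => sq_nonneg _
  have hN0 : 0 ≤ N := integral_nonneg fun x => sq_nonneg _
  have h3 : t ^ 2 * X ≤ ∫ x, (sig U r 1 x * (σ x * u x)) ^ 2 := by
    rw [hX, ← integral_const_mul]
    apply integral_mono (iX.const_mul _)
    · exact integ (((sig_smooth U r hr k hk one_pos).mul hv).pow 2) huc (fun x hx => by simp [hx])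
    · intro x
      have hs := sig_scale U r hr k hk ht1 x
      have hp := sig_pos U r hr k hk hcpos x
      calc t ^ 2 * (σ x * (σ x * u x)) ^ 2 = (t * σ x) ^ 2 * (σ x * u x) ^ 2 := by ring
        _ ≤ (sig U r 1 x) ^ 2 * (σ x * u x) ^ 2 := by gcongr
        _ = _ := by ring
  have h4 : t ^ 2 * X ≤ C * ((d * L ^ 2 + 1 / 4) * X + N) :=
    h3.trans (h1.trans (mul_le_mul_of_nonneg_left h2 hC))
  have h5 : C * (d * L ^ 2 + 1 / 4) ≤ t ^ 2 / 2 := by nlinarith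
  have h6 : C ≤ t ^ 2 := by nlinarith
  have h7 : X ≤ 2 * N := by
    have a1 := mul_le_mul_of_nonneg_right h5 hX0
    have a2 := mul_le_mul_of_nonneg_right h6 hN0
    have ht2 : 0 < t ^ 2 := by positivity
    have : t ^ 2 * X ≤ t ^ 2 * (2 * N) := by nlinarith
    exact le_of_mul_le_mul_left this ht2
  have h8 : ∫ x, (Vp U x * u x) ^ 2 ≤ (p * c ^ 2) ^ 2 * X := by
    rw [hX, ← integral_const_mul]
    apply integral_mono _ (iX.const_mul _)
    · intro x
      have hV0 : 0 ≤ Vp U x := Finset.sum_nonneg fun j _ => sq_nonneg _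
      have hV : Vp U x ≤ p * c ^ 2 * σ x ^ 2 := by
        calc Vp U x ≤ ∑ m : Fin p, c ^ 2 * σ x ^ 2 := by
              refine Finset.sum_le_sum fun m _ => ?_
              have := sig_bound U r hr k hk hcpos 0 (U m) ((mem_Fam_zero U _).2 ⟨m, rfl⟩) x
              rw [abs_div, abs_of_pos hcpos, div_le_iff₀ hcpos, zero_add, pow_one] at this
              rw [← sq_abs, ← mul_pow, mul_comm c]
              gcongr
          _ = _ := by simp; ring
      calc (Vp U x * u x) ^ 2 = (Vp U x) ^ 2 * u x ^ 2 := by ring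
        _ ≤ (p * c ^ 2 * σ x ^ 2) ^ 2 * u x ^ 2 := by gcongr
        _ = (p * c ^ 2) ^ 2 * (σ x * (σ x * u x)) ^ 2 := by ring
    · exact integ (((Vp_smooth U).mul hu).pow 2) huc (fun x hx => by simp [hx])
  calc _ ≤ (p * c ^ 2) ^ 2 * X := h8
    _ ≤ (p * c ^ 2) ^ 2 * (2 * N) := by gcongr
    _ = _ := by ring

lemma max_est {d p : ℕ} (U : Fin p → MvPolynomial (Fin d) ℝ) :
    ∃ C ≥ 0, ∀ u : Rd d → ℝ, ContDiff ℝ ∞ u → HasCompactSupport u →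
      ∫ x, (Vp U x * u x) ^ 2 ≤ C * ∫ x, (PR U u x) ^ 2 := by
  by_cases h : ∃ k, U k ≠ 0
  · obtain ⟨k, hk⟩ := h
    exact max_est_ne U k hk
  · push Not at h
    refine ⟨0, le_rfl, fun u _ _ => ?_⟩
    simp [Vp, h, ev]

lemma hess_est {d : ℕ} {u : Rd d → ℝ} (hu : ContDiff ℝ ∞ u) (hc : HasCompactSupport u)
    (j l : Fin d) :
    ∫ x, (pdR j (pdR l u) x) ^ 2 ≤ ∫ x, (∑ i, pdR i (pdR i u) x) ^ 2 := by
  have s1 : ∀ i, ContDiff ℝ ∞ (pdR i u) := fun i => pdR_smooth hu i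
  have s2 : ∀ i k, ContDiff ℝ ∞ (pdR k (pdR i u)) := fun i k => pdR_smooth (s1 i) k
  have z1 : ∀ i x, x ∉ tsupport u → pdR i u x = 0 := fun i x hx => pdR_zero_of hx i
  have z2 : ∀ i k x, x ∉ tsupport u → pdR k (pdR i u) x = 0 := fun i k x hx =>
    pdR_zero_of (fun h => hx (pdR_tsupport u i h)) k
  have iH : ∀ i k, Integrable (fun x => (pdR i (pdR k u) x) ^ 2) := fun i k =>
    integ' ((s2 k i).pow 2) hc (fun x hx => by simp [z2 k i x hx])
  have iP : ∀ i k, Integrable (fun x => pdR i (pdR i u) x * pdR k (pdR k u) x) := fun i k =>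
    integ' ((s2 i i).mul (s2 k k)) hc (fun x hx => by simp [z2 i i x hx])
  have key : ∀ i k, ∫ x, (pdR i (pdR k u) x) ^ 2 = ∫ x, pdR i (pdR i u) x * pdR k (pdR k u) x := by
    intro i k
    have g1s : ContDiff ℝ ∞ (fun x => pdR k u x * pdR i (pdR k u) x) := (s1 k).mul (s2 k i)
    have g2s : ContDiff ℝ ∞ (fun x => pdR k u x * pdR i (pdR i u) x) := (s1 k).mul (s2 i i)
    have g1c : HasCompactSupport (fun x => pdR k u x * pdR i (pdR k u) x) :=
      HasCompactSupport.intro hc fun x hx => by simp [z1 k x hx]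
    have g2c : HasCompactSupport (fun x => pdR k u x * pdR i (pdR i u) x) :=
      HasCompactSupport.intro hc fun x hx => by simp [z1 k x hx]
    have t1 := integral_pdR g1s g1c i
    have t2 := integral_pdR g2s g2c k
    have j1 := smooth_integrable (pdR_smooth g1s i) (pdR_supp g1c i)
    have j2 := smooth_integrable (pdR_smooth g2s k) (pdR_supp g2c k)
    have hpt : ∀ x, (pdR i (pdR k u) x) ^ 2 = pdR i (pdR i u) x * pdR k (pdR k u) x +
        (pdR i (fun x => pdR k u x * pdR i (pdR k u) x) x -
         pdR k (fun x => pdR k u x * pdR i (pdR i u) x) x) := by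
      intro x
      rw [pdR_mul (s1 k) (s2 k i), pdR_mul (s1 k) (s2 i i)]
      have e1 : pdR i (pdR k u) = pdR k (pdR i u) := funext fun y => pdR_comm hu i k y
      have e2 : pdR i (pdR i (pdR k u)) x = pdR k (pdR i (pdR i u)) x := by
        rw [e1, pdR_comm (s1 i)]
      rw [e2]; ring
    have j3 : Integrable (fun x => pdR i (fun x => pdR k u x * pdR i (pdR k u) x) x -
         pdR k (fun x => pdR k u x * pdR i (pdR i u) x) x) := j1.sub j2
    rw [integral_congr_ae (Eventually.of_forall hpt), integral_add (iP i k) j3, integral_sub j1 j2,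
      t1, t2]
    ring
  have e : ∫ x, (∑ i, pdR i (pdR i u) x) ^ 2 = ∑ i, ∑ k, ∫ x, (pdR i (pdR k u) x) ^ 2 := by
    simp only [key]
    have : ∀ x, (∑ i, pdR i (pdR i u) x) ^ 2 = ∑ i, ∑ k, pdR i (pdR i u) x * pdR k (pdR k u) x := by
      intro x; rw [sq, Finset.sum_mul_sum]
    simp only [this]
    rw [integral_finsetSum _ fun i _ => integrable_finsetSum _ fun k _ => iP i k]
    refine Finset.sum_congr rfl fun i _ => ?_
    rw [integral_finsetSum _ fun k _ => iP i k]
  rw [e]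
  have hn : ∀ i k, 0 ≤ ∫ x, (pdR i (pdR k u) x) ^ 2 := fun i k => integral_nonneg fun x => sq_nonneg _
  calc _ ≤ ∑ k, ∫ x, (pdR j (pdR k u) x) ^ 2 :=
        Finset.single_le_sum (f := fun k => ∫ x, (pdR j (pdR k u) x) ^ 2) (fun k _ => hn j k) (Finset.mem_univ l)
    _ ≤ _ := Finset.single_le_sum (f := fun i => ∑ k, ∫ x, (pdR i (pdR k u) x) ^ 2)
          (fun i _ => Finset.sum_nonneg fun k _ => hn i k) (Finset.mem_univ j)

lemma lap_est {d p : ℕ} (U : Fin p → MvPolynomial (Fin d) ℝ) {u : Rd d → ℝ}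
    (hu : ContDiff ℝ ∞ u) (hc : HasCompactSupport u) :
    ∫ x, (∑ i, pdR i (pdR i u) x) ^ 2 ≤
      2 * (∫ x, (Vp U x * u x) ^ 2) + 2 * ∫ x, (PR U u x) ^ 2 := by
  have i1 : Integrable (fun x => 2 * (Vp U x * u x) ^ 2) :=
    (integ (((Vp_smooth U).mul hu).pow 2) hc (fun x hx => by simp [hx])).const_mul _
  have i2 : Integrable (fun x => 2 * (PR U u x) ^ 2) :=
    (integ' ((PR_smooth U hu).pow 2) hc (fun x hx => by simp [PR_zero U hx])).const_mul _
  rw [← integral_const_mul, ← integral_const_mul, ← integral_add i1 i2]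
  apply integral_mono _ (i1.add i2)
  · intro x
    have : ∑ i, pdR i (pdR i u) x = Vp U x * u x - PR U u x := by unfold PR; ring
    simp only [this, Pi.add_apply]
    nlinarith [sq_nonneg (Vp U x * u x + PR U u x)]
  · exact integ' ((lap_smooth hu).pow 2) hc (fun x hx => by simp [lap_zero hx])

/-- The complex operator. -/
def PC {d p : ℕ} (U : Fin p → MvPolynomial (Fin d) ℝ) (u : Rd d → ℂ) (x : Rd d) : ℂ :=
  -(∑ j, pdC j (pdC j u) x) + ((Vp U x : ℝ) : ℂ) * u x

lemma pdC_clm {d : ℕ} {u : Rd d → ℂ} (hu : ContDiff ℝ ∞ u) (A : ℂ →L[ℝ] ℝ) (j : Fin d) (x : Rd d) :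
    A (pdC j u x) = pdR j (fun y => A (u y)) x := by
  unfold pdC pdR
  have := (A.hasFDerivAt (x := u x)).comp x (hu.differentiable (by simp) x).hasFDerivAt
  have h2 : (fun y => A (u y)) = A ∘ u := rfl
  rw [h2, this.fderiv]
  rfl

lemma pdC_smooth {d : ℕ} {f : Rd d → ℂ} (hf : ContDiff ℝ ∞ f) (j : Fin d) :
    ContDiff ℝ ∞ (pdC j f) := by
  unfold pdC
  exact (hf.fderiv_right (m := ∞) (by simp)).clm_apply contDiff_const

lemma pdC2_clm {d : ℕ} {u : Rd d → ℂ} (hu : ContDiff ℝ ∞ u) (A : ℂ →L[ℝ] ℝ) (j l : Fin d) (x : Rd d) :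
    A (pdC j (pdC l u) x) = pdR j (pdR l (fun y => A (u y))) x := by
  rw [pdC_clm (pdC_smooth hu l)]
  congr 1
  funext y
  exact pdC_clm hu A l y

lemma PC_clm {d p : ℕ} (U : Fin p → MvPolynomial (Fin d) ℝ) {u : Rd d → ℂ} (hu : ContDiff ℝ ∞ u)
    (A : ℂ →L[ℝ] ℝ) (x : Rd d) : A (PC U u x) = PR U (fun y => A (u y)) x := by
  unfold PC PR
  rw [map_add, map_neg, map_sum, ← Complex.real_smul, map_smul]
  simp only [pdC2_clm hu, smul_eq_mul]

lemma split_int {d : ℕ} (w : Rd d → ℂ)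
    (h1 : Integrable (fun x => (Complex.reCLM (w x)) ^ 2)) (h2 : Integrable (fun x => (Complex.imCLM (w x)) ^ 2)) :
    ∫ x, ‖w x‖ ^ 2 = (∫ x, (Complex.reCLM (w x)) ^ 2) + ∫ x, (Complex.imCLM (w x)) ^ 2 := by
  rw [← integral_add h1 h2]
  congr 1
  funext x
  rw [Complex.sq_norm, Complex.normSq_apply]
  simp only [Complex.reCLM_apply, Complex.imCLM_apply]
  ring

lemma complex_est {d p : ℕ} (U : Fin p → MvPolynomial (Fin d) ℝ) :
    ∃ C ≥ 0, ∀ u : Rd d → ℂ, ContDiff ℝ ∞ u → HasCompactSupport u →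
      (∀ j l, ∫ x, ‖pdC j (pdC l u) x‖ ^ 2 ≤ C * ∫ x, ‖PC U u x‖ ^ 2) ∧
      ∫ x, Vp U x ^ 2 * ‖u x‖ ^ 2 ≤ C * ∫ x, ‖PC U u x‖ ^ 2 := by
  obtain ⟨C, hC, hmax⟩ := max_est U
  refine ⟨2 * C + 2, by positivity, fun u hu hc => ?_⟩
  have sA : ∀ A : ℂ →L[ℝ] ℝ, ContDiff ℝ ∞ (fun y => A (u y)) := fun A => A.contDiff.comp hu
  have cA : ∀ A : ℂ →L[ℝ] ℝ, HasCompactSupport (fun y => A (u y)) := fun A =>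
    hc.comp_left (g := A) (map_zero A)
  have iP : ∀ A : ℂ →L[ℝ] ℝ, Integrable (fun x => (A (PC U u x)) ^ 2) := fun A => by
    simp only [PC_clm U hu]
    exact integ' ((PR_smooth U (sA A)).pow 2) (cA A) (fun x hx => by simp [PR_zero U hx])
  have hP := split_int (PC U u) (iP _) (iP _)
  have bV : ∀ A : ℂ →L[ℝ] ℝ, ∫ x, (A ((Vp U x : ℝ) * u x)) ^ 2 ≤ C * ∫ x, (A (PC U u x)) ^ 2 := fun A => by
    simp only [PC_clm U hu, ← Complex.real_smul, map_smul, smul_eq_mul]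
    exact hmax _ (sA A) (cA A)
  have bH : ∀ (A : ℂ →L[ℝ] ℝ) (j l : Fin d), ∫ x, (A (pdC j (pdC l u) x)) ^ 2 ≤
      (2 * C + 2) * ∫ x, (A (PC U u x)) ^ 2 := fun A j l => by
    simp only [PC_clm U hu, pdC2_clm hu]
    have h1 := hess_est (sA A) (cA A) j l
    have h2 := lap_est U (sA A) (cA A)
    have h3 := hmax _ (sA A) (cA A)
    linarith
  have hn : ∀ A : ℂ →L[ℝ] ℝ, 0 ≤ ∫ x, (A (PC U u x)) ^ 2 := fun A => integral_nonneg fun x => sq_nonneg _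
  constructor
  · intro j l
    have iH : ∀ A : ℂ →L[ℝ] ℝ, Integrable (fun x => (A (pdC j (pdC l u) x)) ^ 2) := fun A => by
      simp only [pdC2_clm hu]
      exact smooth_integrable ((pdR_smooth (pdR_smooth (sA A) l) j).pow 2)
        (cs_of (pdR_supp (pdR_supp (cA A) l) j) (fun x hx => by simp [hx]))
    rw [split_int _ (iH _) (iH _), hP]
    linarith [bH Complex.reCLM j l, bH Complex.imCLM j l]
  · have iV : ∀ A : ℂ →L[ℝ] ℝ, Integrable (fun x => (A ((Vp U x : ℝ) * u x)) ^ 2) := fun A => by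
      simp only [← Complex.real_smul, map_smul, smul_eq_mul]
      exact integ (((Vp_smooth U).mul (sA A)).pow 2) (cA A) (fun x hx => by simp [hx])
    have e : ∀ x, Vp U x ^ 2 * ‖u x‖ ^ 2 = ‖((Vp U x : ℝ) : ℂ) * u x‖ ^ 2 := fun x => by
      rw [norm_mul, mul_pow, Complex.norm_real, Real.norm_eq_abs, sq_abs]
    simp only [e]
    rw [split_int _ (iV _) (iV _), hP]
    have p1 := mul_nonneg hC (hn Complex.reCLM)
    have p2 := mul_nonneg hC (hn Complex.imCLM)
    linarith [bV Complex.reCLM, bV Complex.imCLM, hn Complex.reCLM, hn Complex.imCLM]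

/-- maximal estimate for `-Δ + U`, where `U = ∑_j U_j²` is a sum of
squares of real polynomials. -/
theorem statement_9 (d p : ℕ) (U : Fin p → MvPolynomial (Fin d) ℝ) :
    ∃ C > 0, ∀ u : Rd d → ℂ, ContDiff ℝ (⊤ : ℕ∞) u → HasCompactSupport u →
      (∑ j, ∑ ℓ, Real.sqrt (∫ x : Rd d, ‖pdC j (pdC ℓ u) x‖^2))
        + Real.sqrt (∫ x : Rd d,
            (∑ m, (MvPolynomial.eval (fun i => x i) (U m))^2)^2 * ‖u x‖^2)
      ≤ C * Real.sqrt (∫ x : Rd d,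
          ‖-(∑ j, pdC j (pdC j u) x)
            + ((∑ m, (MvPolynomial.eval (fun i => x i) (U m))^2 : ℝ) : ℂ) * u x‖^2) := by
  obtain ⟨C, hC, h⟩ := complex_est U
  refine ⟨(d * d + 1) * (Real.sqrt C + 1), by positivity, fun u hu hc => ?_⟩
  obtain ⟨h1, h2⟩ := h u hu hc
  change (∑ j, ∑ ℓ, Real.sqrt (∫ x : Rd d, ‖pdC j (pdC ℓ u) x‖^2))
        + Real.sqrt (∫ x : Rd d, Vp U x ^ 2 * ‖u x‖^2)
      ≤ (d * d + 1) * (Real.sqrt C + 1) * Real.sqrt (∫ x : Rd d, ‖PC U u x‖ ^ 2)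
  set N := ∫ x : Rd d, ‖PC U u x‖ ^ 2 with hN
  have h3 : ∀ y, y ≤ C * N → Real.sqrt y ≤ (Real.sqrt C + 1) * Real.sqrt N := fun y hy => by
    calc Real.sqrt y ≤ Real.sqrt (C * N) := Real.sqrt_le_sqrt hy
      _ = Real.sqrt C * Real.sqrt N := Real.sqrt_mul hC _
      _ ≤ _ := by gcongr; linarith
  have h4 : (∑ j, ∑ ℓ, Real.sqrt (∫ x : Rd d, ‖pdC j (pdC ℓ u) x‖^2)) ≤
      ∑ j : Fin d, ∑ l : Fin d, (Real.sqrt C + 1) * Real.sqrt N :=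
    Finset.sum_le_sum fun j _ => Finset.sum_le_sum fun l _ => h3 _ (h1 j l)
  have h5 := h3 _ h2
  simp only [Finset.sum_const, Finset.card_univ, Fintype.card_fin, nsmul_eq_mul] at h4
  linarith

end
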